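/- Let (E = E_{−n}⊕⋯⊕E_{−1}, μ = l_1 + ⋯ + l_{n+1}) be a symmetric Lie n-algebra (an L∞-structure on a graded vector space concentrated in degrees −n,…,−1; by degree reasons only l_1,…,l_{n+1} can be nonzero). Let k be an integer with (n+3)/2 ≤ k ≤ n+1 and let N be any symmetric vector valued k-form of degree 0 on E. Then S + N is a Nijenhuis vector valued form with respect to μ with square S + 2N, and the deformed L∞-structure is [S+N, μ]_RN = l_1 + ⋯ + l_{k−1} + (l_k + [N,l_1]_RN) + ⋯ + (l_{n+1} + [N,l_{n−k+2}]_RN). -/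

import Mathlib

open scoped DirectSum
open Classical

noncomputable section

namespace RN

section Core

variable (𝕜 : Type) [Field 𝕜] [CharZero 𝕜]
variable (E : ℤ → Type) [∀ i, AddCommGroup (E i)] [∀ i, Module 𝕜 (E i)]

/-- Raw vector-valued forms on the graded vector space `E`: for every arity `n` and every
vector of (input) degrees `ι`, a function on homogeneous tuples with values in the total
graded space `⨁ i, E i`. -/
abbrev RawForm : Type :=
  ∀ n : ℕ, ∀ ι : Fin n → ℤ, (∀ j, E (ι j)) → ⨁ i, E i

/-- Multilinearity (in each slot, on homogeneous arguments). -/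
def IsMultilin (F : RawForm E) : Prop :=
  ∀ (n : ℕ) (ι : Fin n → ℤ) (x : ∀ j, E (ι j)) (j : Fin n) (a b : E (ι j)) (c : 𝕜),
    F n ι (Function.update x j (a + b)) =
        F n ι (Function.update x j a) + F n ι (Function.update x j b) ∧
      F n ι (Function.update x j (c • a)) = c • F n ι (Function.update x j a)

/-- Graded symmetry: swapping two adjacent homogeneous arguments multiplies the value
by the Koszul sign `(-1)^{|X||Y|}`. -/
def IsGradedSym (F : RawForm E) : Prop :=
  ∀ (n : ℕ) (ι : Fin n → ℤ) (x : ∀ j, E (ι j)) (p q : Fin n), (p : ℕ) + 1 = (q : ℕ) →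
    F n (fun j => ι (Equiv.swap p q j)) (fun j => x (Equiv.swap p q j)) =
      ((-1 : 𝕜) ^ (ι p * ι q)) • F n ι x

/-- `F` has degree `d`: its value on homogeneous arguments of degrees `ι` is homogeneous
of degree `(∑ j, ι j) + d`. -/
def IsOfDeg (d : ℤ) (F : RawForm E) : Prop :=
  ∀ (n : ℕ) (ι : Fin n → ℤ) (x : ∀ j, E (ι j)) (m : ℤ),
    m ≠ (∑ j, ι j) + d → F n ι x m = 0

/-- Symmetric vector valued form of degree `d`. -/
def IsSVF (d : ℤ) (F : RawForm E) : Prop :=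
  IsMultilin 𝕜 E F ∧ IsGradedSym 𝕜 E F ∧ IsOfDeg E d F

/-- `F` is (concentrated in) a `k`-form. -/
def IsArity (k : ℕ) (F : RawForm E) : Prop :=
  ∀ n, n ≠ k → ∀ (ι : Fin n → ℤ) (x : ∀ j, E (ι j)), F n ι x = 0

/-- `F` has no 0-form (curvature) component. -/
def NoCurv (F : RawForm E) : Prop :=
  ∀ (ι : Fin 0 → ℤ) (x : ∀ j, E (ι j)), F 0 ι x = 0

/-- `(k, n-k)`-shuffles of `Fin n`. -/
def IsShuffle (k : ℕ) {n : ℕ} (σ : Equiv.Perm (Fin n)) : Prop :=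
  ∀ i j : Fin n, i < j → ((j : ℕ) < k ∨ k ≤ (i : ℕ)) → σ i < σ j

/-- The Koszul sign of the rearrangement `(X_{σ(1)},…,X_{σ(n)})` of homogeneous elements
of degrees `ι`. -/
def koszulSign {n : ℕ} (ι : Fin n → ℤ) (σ : Equiv.Perm (Fin n)) : 𝕜 :=
  ∏ p ∈ Finset.univ.filter (fun p : Fin n × Fin n => p.1 < p.2 ∧ σ p.2 < σ p.1),
    (-1 : 𝕜) ^ (ι (σ p.1) * ι (σ p.2))

/-- Prepend a degree to a vector of degrees. -/
def dcons {n : ℕ} (m : ℤ) (rest : Fin n → ℤ) : Fin (n + 1) → ℤ :=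
  fun j => if h : (j : ℕ) = 0 then m else rest ⟨(j : ℕ) - 1, by have := j.isLt; omega⟩

/-- Prepend a homogeneous element to a tuple of homogeneous elements. -/
def dconsV {n : ℕ} {m : ℤ} {rest : Fin n → ℤ} (v : E m) (xs : ∀ i, E (rest i)) :
    ∀ j : Fin (n + 1), E (dcons m rest j) := fun j => by
  unfold dcons
  by_cases h : (j : ℕ) = 0
  · rw [dif_pos h]; exact v
  · rw [dif_neg h]; exact xs ⟨(j : ℕ) - 1, by have := j.isLt; omega⟩

/-- The insertion operator `ι_F G`, summing over shuffles with Koszul signs. -/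
def ins (F G : RawForm E) : RawForm E :=
  fun n ι x =>
    ∑ k : Fin (n + 1),
      ∑ σ ∈ Finset.univ.filter (fun σ : Equiv.Perm (Fin n) => IsShuffle (k : ℕ) σ),
        koszulSign 𝕜 ι σ •
          DFinsupp.sum
            (F (k : ℕ)
              (fun i => ι (σ ⟨(i : ℕ), by have h1 := i.isLt; have h2 := k.isLt; omega⟩))
              (fun i => x (σ ⟨(i : ℕ), by have h1 := i.isLt; have h2 := k.isLt; omega⟩)))
            (fun m v =>
              G (n - (k : ℕ) + 1)
                (dcons m
                  (fun i => ι (σ ⟨(k : ℕ) + (i : ℕ), by have h1 := i.isLt; have h2 := k.isLt; omega⟩)))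
                (dconsV E v
                  (fun i => x (σ ⟨(k : ℕ) + (i : ℕ), by have h1 := i.isLt; have h2 := k.isLt; omega⟩))))

/-- The Richardson–Nijenhuis bracket `[F,G]_RN = ι_F G - (-1)^{dK·dL} ι_G F` of forms
of degrees `dK` and `dL`. -/
def rnb (dK dL : ℤ) (F G : RawForm E) : RawForm E :=
  fun n ι x => ins 𝕜 E F G n ι x - ((-1 : 𝕜) ^ (dK * dL)) • ins 𝕜 E G F n ι x

/-- An element of the graded vector space, regarded as a vector valued 0-form. -/
def ofElem (v : ⨁ i, E i) : RawForm E := fun n _ _ => if n = 0 then v else 0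

/-- The Euler map `S(X) = -|X|·X`, a vector valued 1-form of degree 0. -/
def euler : RawForm E :=
  fun n ι x =>
    if h : n = 1 then
      (-(ι ⟨0, by omega⟩)) • DirectSum.of E (ι ⟨0, by omega⟩) (x ⟨0, by omega⟩)
    else 0

/-- The identity map of `E`, regarded as a vector valued 1-form of degree 0. -/
def idF : RawForm E :=
  fun n ι x =>
    if h : n = 1 then DirectSum.of E (ι ⟨0, by omega⟩) (x ⟨0, by omega⟩) else 0

/-- The arity-`k` component of a vector valued form. -/
def comp (F : RawForm E) (k : ℕ) : RawForm E :=
  fun n ι x => if n = k then F n ι x else 0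

end Core

section KoszulSign

variable {𝕜 : Type} [Field 𝕜]

theorem neg_one_zpow_mul_self (z : ℤ) : (-1 : 𝕜) ^ z * (-1 : 𝕜) ^ z = 1 := by
  rw [← mul_zpow]; simp

theorem koszulSign_one {n : ℕ} (ι : Fin n → ℤ) : koszulSign 𝕜 ι 1 = 1 := by
  unfold koszulSign
  rw [Finset.filter_false_of_mem, Finset.prod_empty]
  rintro p - ⟨h1, h2⟩
  exact absurd h1 (not_lt.mpr h2.le)

theorem koszulSign_mul_self {n : ℕ} (ι : Fin n → ℤ) (σ : Equiv.Perm (Fin n)) :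
    koszulSign 𝕜 ι σ * koszulSign 𝕜 ι σ = 1 := by
  unfold koszulSign
  rw [← Finset.prod_mul_distrib]
  exact Finset.prod_eq_one fun p _ => neg_one_zpow_mul_self _

theorem swap_adjacent_lt_iff {n : ℕ} {a b : Fin n} (hab : (a : ℕ) + 1 = b) {i j : Fin n}
    (h : ¬(i = a ∧ j = b)) (h' : ¬(i = b ∧ j = a)) :
    Equiv.swap a b i < Equiv.swap a b j ↔ i < j := by
  simp only [Equiv.swap_apply_def]
  simp only [Fin.ext_iff] at h h'
  split_ifs <;> simp only [Fin.ext_iff, Fin.lt_def] at * <;> omega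

theorem koszulSign_mul_swap {n : ℕ} (ι : Fin n → ℤ) (σ : Equiv.Perm (Fin n)) {a b : Fin n}
    (hab : (a : ℕ) + 1 = b) :
    koszulSign 𝕜 ι (σ * Equiv.swap a b) =
      (-1 : 𝕜) ^ (ι (σ a) * ι (σ b)) * koszulSign 𝕜 ι σ := by
  have hlt : a < b := by rw [Fin.lt_def]; omega
  have hne : a ≠ b := hlt.ne
  unfold koszulSign
  rw [Finset.prod_filter, Finset.prod_filter,
    ← Finset.mul_prod_erase Finset.univ _ (Finset.mem_univ (a, b)),
    ← Finset.mul_prod_erase Finset.univ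
      (fun p : Fin n × Fin n => if p.1 < p.2 ∧ σ p.2 < σ p.1 then
        (-1 : 𝕜) ^ (ι (σ p.1) * ι (σ p.2)) else 1) (Finset.mem_univ (a, b)), ← mul_assoc]
  congr 1
  · simp only [Equiv.Perm.mul_apply, Equiv.swap_apply_left, Equiv.swap_apply_right, hlt, true_and]
    rcases lt_or_gt_of_ne (σ.injective.ne hne) with h | h
    · rw [if_pos h, if_neg h.not_gt, mul_one, mul_comm]
    · rw [if_neg h.not_gt, if_pos h, neg_one_zpow_mul_self]
  · have key : ∀ p : Fin n × Fin n, p ≠ (a, b) → p ≠ (b, a) →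
        (Equiv.swap a b p.1, Equiv.swap a b p.2) ≠ (a, b) := by
      rintro ⟨i, j⟩ - h2 h
      rw [Prod.mk.injEq] at h
      apply h2
      rw [Equiv.swap_apply_eq_iff, Equiv.swap_apply_eq_iff, Equiv.swap_apply_left,
        Equiv.swap_apply_right] at h
      exact Prod.ext h.1 h.2
    rw [← Finset.prod_filter, ← Finset.prod_filter]
    have hba : ∀ p : Fin n × Fin n, p.1 < p.2 → p ≠ (b, a) := by
      rintro p hp rfl
      exact absurd hp hlt.not_gt
    refine Finset.prod_nbij' (fun p => (Equiv.swap a b p.1, Equiv.swap a b p.2))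
      (fun p => (Equiv.swap a b p.1, Equiv.swap a b p.2)) ?_ ?_ ?_ ?_ ?_
    · intro p hp
      obtain ⟨h1, h3, h4⟩ := Finset.mem_filter.mp hp
      have h1 := (Finset.mem_erase.mp h1).1
      have h2 := hba p h3
      refine Finset.mem_filter.mpr ⟨Finset.mem_erase.mpr ⟨key p h1 h2, Finset.mem_univ _⟩, ?_, h4⟩
      exact (swap_adjacent_lt_iff hab (fun h => h1 (Prod.ext h.1 h.2))
        (fun h => h2 (Prod.ext h.1 h.2))).mpr h3
    · intro p hp
      obtain ⟨h1, h3, h4⟩ := Finset.mem_filter.mp hp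
      have h1 := (Finset.mem_erase.mp h1).1
      have h2 := hba p h3
      refine Finset.mem_filter.mpr ⟨Finset.mem_erase.mpr ⟨key p h1 h2, Finset.mem_univ _⟩, ?_, ?_⟩
      · exact (swap_adjacent_lt_iff hab (fun h => h1 (Prod.ext h.1 h.2))
          (fun h => h2 (Prod.ext h.1 h.2))).mpr h3
      · simpa only [Equiv.Perm.mul_apply, Equiv.swap_apply_self] using h4
    · intro p _; simp
    · intro p _; simp
    · intro p _; simp

/-- Adjacent transpositions generate the symmetric group. -/
theorem perm_induction_adjacent {n : ℕ} {P : Equiv.Perm (Fin n) → Prop} (one : P 1)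
    (mul_swap : ∀ (σ : Equiv.Perm (Fin n)) (a b : Fin n), (a : ℕ) + 1 = b → P σ →
      P (σ * Equiv.swap a b)) (σ : Equiv.Perm (Fin n)) : P σ := by
  cases n with
  | zero => rwa [Subsingleton.elim σ 1]
  | succ n =>
    have hσ : σ ∈ Submonoid.closure
        (Set.range fun i : Fin n => Equiv.swap i.castSucc i.succ) := by
      rw [Equiv.Perm.mclosure_swap_castSucc_succ]; trivial
    induction hσ using Submonoid.closure_induction_right with
    | one => exact one
    | mul_right σ _ τ hτ ih =>
      obtain ⟨i, rfl⟩ := hτ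
      exact mul_swap σ _ _ (by simp) ih

theorem koszulSign_mul {n : ℕ} (ι : Fin n → ℤ) (σ τ : Equiv.Perm (Fin n)) :
    koszulSign 𝕜 ι (σ * τ) = koszulSign 𝕜 ι σ * koszulSign 𝕜 (fun j => ι (σ j)) τ := by
  induction τ using perm_induction_adjacent with
  | one => rw [mul_one, koszulSign_one, mul_one]
  | mul_swap τ a b hab ih =>
    rw [← mul_assoc, koszulSign_mul_swap _ _ hab, koszulSign_mul_swap _ _ hab, ih]
    simp only [Equiv.Perm.mul_apply]
    ring

theorem koszulSign_comp_swap {n : ℕ} (ι : Fin n → ℤ) (σ : Equiv.Perm (Fin n)) {p q : Fin n}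
    (hpq : (p : ℕ) + 1 = q) :
    koszulSign 𝕜 (fun j => ι (Equiv.swap p q j)) σ =
      (-1 : 𝕜) ^ (ι p * ι q) * koszulSign 𝕜 ι (Equiv.swap p q * σ) := by
  have h : koszulSign 𝕜 ι (Equiv.swap p q) = (-1 : 𝕜) ^ (ι p * ι q) := by
    have := koszulSign_mul_swap (𝕜 := 𝕜) ι 1 hpq
    rwa [one_mul, koszulSign_one, mul_one] at this
  rw [koszulSign_mul, h, ← mul_assoc, neg_one_zpow_mul_self, one_mul]

end KoszulSign

section Update

variable {E : ℤ → Type}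

theorem update_dconsV_zero {l : ℕ} {m : ℤ} {rest : Fin l → ℤ} (v w : E m)
    (xs : ∀ j, E (rest j)) :
    Function.update (dconsV E v xs) 0 w = dconsV E w xs := by
  funext j
  refine Fin.cases ?_ (fun i => ?_) j
  · exact Function.update_self (0 : Fin (l + 1)) _ (dconsV E v xs)
  · exact Function.update_of_ne (Fin.succ_ne_zero i) _ (dconsV E v xs)

theorem update_dconsV_succ {l : ℕ} {m : ℤ} {rest : Fin l → ℤ} (v : E m)
    (xs : ∀ j, E (rest j)) (i : Fin l) (w : E (rest i)) :
    Function.update (dconsV E v xs) i.succ w = dconsV E v (Function.update xs i w) := by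
  funext j
  refine Fin.cases ?_ (fun i' => ?_) j
  · exact Function.update_of_ne (Fin.succ_ne_zero i).symm _ (dconsV E v xs)
  · by_cases h : i' = i
    · subst h
      exact (Function.update_self i'.succ _ (dconsV E v xs)).trans
        (Function.update_self i' w xs).symm
    · have e : Function.update xs i w i' = xs i' := Function.update_of_ne h w xs
      exact (Function.update_of_ne (by simpa using h) _ (dconsV E v xs)).trans e.symm

end Update

section Forms

variable {𝕜 : Type} [Field 𝕜]
variable {E : ℤ → Type} [∀ i, AddCommGroup (E i)] [∀ i, Module 𝕜 (E i)]

theorem IsGradedSym.apply_perm {F : RawForm E} (hF : IsGradedSym 𝕜 E F) {n : ℕ}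
    (σ : Equiv.Perm (Fin n)) (ι : Fin n → ℤ) (x : ∀ j, E (ι j)) :
    F n (fun j => ι (σ j)) (fun j => x (σ j)) = koszulSign 𝕜 ι σ • F n ι x := by
  induction σ using perm_induction_adjacent with
  | one => rw [koszulSign_one, one_smul]; rfl
  | mul_swap σ a b hab ih =>
    have := hF n (fun j => ι (σ j)) (fun j => x (σ j)) a b hab
    rw [koszulSign_mul_swap _ _ hab, mul_smul, ← ih]
    exact this

variable (𝕜) in
/-- Homogeneity of degree one in each slot. -/
def IsHomogeneous (F : RawForm E) : Prop :=
  ∀ (n : ℕ) (ι : Fin n → ℤ) (x : ∀ j, E (ι j)) (j : Fin n) (c : 𝕜),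
    F n ι (Function.update x j (c • x j)) = c • F n ι x

/-- Additivity in the first slot. -/
def IsAdditiveFirst (G : RawForm E) : Prop :=
  ∀ (l : ℕ) (rest : Fin l → ℤ) (xs : ∀ j, E (rest j)) (m : ℤ) (v w : E m),
    G (l + 1) (dcons m rest) (dconsV E (v + w) xs) =
      G (l + 1) (dcons m rest) (dconsV E v xs) + G (l + 1) (dcons m rest) (dconsV E w xs)

theorem IsMultilin.isHomogeneous {F : RawForm E} (hF : IsMultilin 𝕜 E F) :
    IsHomogeneous 𝕜 F := fun n ι x j c => by
  rw [(hF n ι x j (x j) (x j) c).2, Function.update_eq_self]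

theorem IsMultilin.isAdditiveFirst {F : RawForm E} (hF : IsMultilin 𝕜 E F) :
    IsAdditiveFirst F := fun l rest xs m v w => by
  have := (hF (l + 1) (dcons m rest) (dconsV E v xs) 0 v w 1).1
  have e (u : E m) := congrArg (F (l + 1) (dcons m rest)) (update_dconsV_zero v u xs)
  exact (e (v + w)).symm.trans (this.trans (congrArg₂ (· + ·) (e v) (e w)))

theorem IsAdditiveFirst.apply_zero {G : RawForm E} (hG : IsAdditiveFirst G) {l : ℕ}
    (rest : Fin l → ℤ) (xs : ∀ j, E (rest j)) (m : ℤ) :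
    G (l + 1) (dcons m rest) (dconsV E 0 xs) = 0 := by
  simpa using hG l rest xs m 0 0

theorem IsHomogeneous.apply_smul_first {G : RawForm E} (hG : IsHomogeneous 𝕜 G) {l : ℕ}
    (rest : Fin l → ℤ) (xs : ∀ j, E (rest j)) (m : ℤ) (c : 𝕜) (v : E m) :
    G (l + 1) (dcons m rest) (dconsV E (c • v) xs) =
      c • G (l + 1) (dcons m rest) (dconsV E v xs) := by
  rw [← hG _ _ _ 0 c]
  exact congrArg _ (update_dconsV_zero v (c • v) xs).symm

theorem IsHomogeneous.apply_eq_zero {F : RawForm E} (hF : IsHomogeneous 𝕜 F) {n : ℕ}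
    {ι : Fin n → ℤ} {x : ∀ j, E (ι j)} {j : Fin n} (h : x j = 0) : F n ι x = 0 := by
  rw [← zero_smul 𝕜 (F n ι x), ← hF n ι x j 0, zero_smul, ← h, Function.update_eq_self]

/-- Evaluation of `G` on an inhomogeneous first argument. -/
def plug (G : RawForm E) (f : ⨁ i, E i) {l : ℕ} (rest : Fin l → ℤ) (xs : ∀ j, E (rest j)) :
    ⨁ i, E i :=
  DFinsupp.sum f fun m v => G (l + 1) (dcons m rest) (dconsV E v xs)

@[simp] theorem plug_zero (G : RawForm E) {l : ℕ} (rest : Fin l → ℤ) (xs : ∀ j, E (rest j)) :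
    plug G 0 rest xs = 0 := DFinsupp.sum_zero_index

theorem plug_add_form (G H : RawForm E) (f : ⨁ i, E i) {l : ℕ} (rest : Fin l → ℤ)
    (xs : ∀ j, E (rest j)) :
    plug (G + H) f rest xs = plug G f rest xs + plug H f rest xs :=
  DFinsupp.sum_add

theorem plug_add {G : RawForm E} (hG : IsAdditiveFirst G) (f g : ⨁ i, E i) {l : ℕ}
    (rest : Fin l → ℤ) (xs : ∀ j, E (rest j)) :
    plug G (f + g) rest xs = plug G f rest xs + plug G g rest xs :=
  DFinsupp.sum_add_index (fun _ => hG.apply_zero _ _ _) fun _ _ _ => hG _ _ _ _ _ _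

theorem plug_of {G : RawForm E} (hG : IsHomogeneous 𝕜 G) {l : ℕ} (rest : Fin l → ℤ)
    (xs : ∀ j, E (rest j)) (m : ℤ) (v : E m) :
    plug G (DirectSum.of E m v) rest xs = G (l + 1) (dcons m rest) (dconsV E v xs) :=
  DFinsupp.sum_single_index (hG.apply_eq_zero (j := 0) rfl)

theorem plug_smul {G : RawForm E} (hG : IsHomogeneous 𝕜 G) (c : 𝕜) (f : ⨁ i, E i) {l : ℕ}
    (rest : Fin l → ℤ) (xs : ∀ j, E (rest j)) :
    plug G (c • f) rest xs = c • plug G f rest xs := by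
  have h : c • f = DFinsupp.mapRange (fun _ v => c • v) (fun _ => smul_zero c) f := by
    ext i; rfl
  rw [h, plug]
  refine (DFinsupp.sum_mapRange_index
    (h := fun m v => G (l + 1) (dcons m rest) (dconsV E v xs))
    fun _ => hG.apply_eq_zero (j := 0) rfl).trans ?_
  rw [plug, DFinsupp.sum, DFinsupp.sum, Finset.smul_sum]
  exact Finset.sum_congr rfl fun m _ => hG.apply_smul_first _ _ _ _ _

theorem plug_update {G : RawForm E} (hG : IsHomogeneous 𝕜 G) (c : 𝕜) (f : ⨁ i, E i) {l : ℕ}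
    (rest : Fin l → ℤ) (xs : ∀ j, E (rest j)) (i : Fin l) :
    plug G f rest (Function.update xs i (c • xs i)) = c • plug G f rest xs := by
  rw [plug, plug, DFinsupp.sum, DFinsupp.sum, Finset.smul_sum]
  refine Finset.sum_congr rfl fun m _ => ?_
  rw [← update_dconsV_succ]
  exact hG _ _ _ i.succ c

theorem plug_swap {G : RawForm E} (hG : IsGradedSym 𝕜 E G) (f : ⨁ i, E i) {l : ℕ}
    (rest : Fin l → ℤ) (xs : ∀ j, E (rest j)) (p q : Fin l) (hpq : (p : ℕ) + 1 = q) :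
    plug G f (fun j => rest (Equiv.swap p q j)) (fun j => xs (Equiv.swap p q j)) =
      (-1 : 𝕜) ^ (rest p * rest q) • plug G f rest xs := by
  rw [plug, plug, DFinsupp.sum, DFinsupp.sum, Finset.smul_sum]
  refine Finset.sum_congr rfl fun m _ => ?_
  refine Eq.trans ?_ (hG (l + 1) (dcons m rest) (dconsV E (f m) xs) p.succ q.succ (by simpa))
  have hs : ∀ j : Fin l, Equiv.swap p.succ q.succ j.succ = (Equiv.swap p q j).succ := by
    intro j
    simp only [Equiv.swap_apply_def, Fin.succ_inj]
    split_ifs <;> rfl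
  have h0 : Equiv.swap p.succ q.succ 0 = 0 :=
    Equiv.swap_apply_of_ne_of_ne (Fin.succ_ne_zero p).symm (Fin.succ_ne_zero q).symm
  have hι : dcons m (fun j => rest (Equiv.swap p q j)) =
      fun j => dcons m rest (Equiv.swap p.succ q.succ j) := by
    funext j
    refine Fin.cases ?_ (fun i => ?_) j
    · rw [h0]; rfl
    · rw [hs]; rfl
  have hx : HEq (dconsV E (f m) (fun j => xs (Equiv.swap p q j)))
      (fun j => dconsV E (f m) xs (Equiv.swap p.succ q.succ j)) := by
    refine Function.hfunext rfl fun j j' hj => ?_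
    obtain rfl := eq_of_heq hj
    refine Fin.cases ?_ (fun i => ?_) j
    · rw [h0]; rfl
    · rw [hs]; rfl
  congr 1

theorem plug_apply_eq_zero {G : RawForm E} {d m₀ : ℤ} (hG : IsOfDeg E d G) {f : ⨁ i, E i}
    (hf : ∀ m, m ≠ m₀ → f m = 0) {l : ℕ} (rest : Fin l → ℤ) (xs : ∀ j, E (rest j)) {m' : ℤ}
    (hm' : m' ≠ m₀ + ∑ j, rest j + d) : plug G f rest xs m' = 0 := by
  rw [plug, DFinsupp.sum, DFinsupp.finsetSum_apply]
  refine Finset.sum_eq_zero fun m hm => ?_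
  refine hG _ _ _ _ ?_
  have : m = m₀ := by
    by_contra h
    exact (DFinsupp.mem_support_iff.mp hm) (hf m h)
  rw [Fin.sum_univ_succ, this]
  exact hm'

/-- The contribution of a pair of blocks of arguments to an insertion. -/
def blockTerm (F G : RawForm E) {n k l : ℕ} (ι : Fin n → ℤ) (x : ∀ j, E (ι j))
    (f : Fin k → Fin n) (g : Fin l → Fin n) : ⨁ i, E i :=
  plug G (F k (fun i => ι (f i)) fun i => x (f i)) (fun i => ι (g i)) fun i => x (g i)

theorem blockTerm_swap_left {F G : RawForm E} (hF : IsGradedSym 𝕜 E F)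
    (hG : IsHomogeneous 𝕜 G) {n k l : ℕ} (ι : Fin n → ℤ) (x : ∀ j, E (ι j))
    (f : Fin k → Fin n) (g : Fin l → Fin n) (a b : Fin k) (hab : (a : ℕ) + 1 = b) :
    blockTerm F G ι x (fun i => f (Equiv.swap a b i)) g =
      (-1 : 𝕜) ^ (ι (f a) * ι (f b)) • blockTerm F G ι x f g := by
  rw [blockTerm, hF k (fun i => ι (f i)) (fun i => x (f i)) a b hab, plug_smul hG, blockTerm]

theorem blockTerm_swap_right {F G : RawForm E} (hG : IsGradedSym 𝕜 E G) {n k l : ℕ}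
    (ι : Fin n → ℤ) (x : ∀ j, E (ι j)) (f : Fin k → Fin n) (g : Fin l → Fin n) (a b : Fin l)
    (hab : (a : ℕ) + 1 = b) :
    blockTerm F G ι x f (fun i => g (Equiv.swap a b i)) =
      (-1 : 𝕜) ^ (ι (g a) * ι (g b)) • blockTerm F G ι x f g :=
  plug_swap hG _ (fun i => ι (g i)) (fun i => x (g i)) a b hab

/-- The positions of the first block of arguments. -/
def leftPos {n : ℕ} (k : Fin (n + 1)) (i : Fin (k : ℕ)) : Fin n :=
  ⟨i, by have h1 := i.isLt; have h2 := k.isLt; omega⟩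

/-- The positions of the second block of arguments. -/
def rightPos {n : ℕ} (k : Fin (n + 1)) (i : Fin (n - k)) : Fin n :=
  ⟨k + i, by have h1 := i.isLt; have h2 := k.isLt; omega⟩

theorem exists_leftPos {n : ℕ} (k : Fin (n + 1)) {j : Fin n} (h : (j : ℕ) < k) :
    ∃ i, j = leftPos k i := ⟨⟨j, h⟩, rfl⟩

theorem exists_rightPos {n : ℕ} (k : Fin (n + 1)) {j : Fin n} (h : (k : ℕ) ≤ j) :
    ∃ i, j = rightPos k i :=
  ⟨⟨j - k, by omega⟩, Fin.ext (by simp only [rightPos]; omega)⟩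

theorem leftPos_injective {n : ℕ} (k : Fin (n + 1)) : Function.Injective (leftPos k) :=
  fun a b h => Fin.ext (by simpa [leftPos] using h)

theorem rightPos_injective {n : ℕ} (k : Fin (n + 1)) : Function.Injective (rightPos k) :=
  fun a b h => Fin.ext (by simpa [rightPos] using h)

theorem leftPos_ne_rightPos {n : ℕ} (k : Fin (n + 1)) (i : Fin (k : ℕ)) (j : Fin (n - k)) :
    leftPos k i ≠ rightPos k j := by
  have := i.isLt
  simp only [leftPos, rightPos, ne_eq, Fin.mk.injEq]
  omega

theorem sum_leftPos_add_sum_rightPos {n : ℕ} (k : Fin (n + 1)) (g : Fin n → ℤ) :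
    ∑ i, g (leftPos k i) + ∑ i, g (rightPos k i) = ∑ j, g j := by
  have h : (k : ℕ) + (n - k) = n := by omega
  rw [← Equiv.sum_comp (finCongr h), Fin.sum_univ_add]
  rfl

variable (𝕜) in
/-- The summand of an insertion indexed by a permutation. -/
def insTerm (F G : RawForm E) {n : ℕ} (ι : Fin n → ℤ) (x : ∀ j, E (ι j)) (k : Fin (n + 1))
    (σ : Equiv.Perm (Fin n)) : ⨁ i, E i :=
  koszulSign 𝕜 ι σ • blockTerm F G ι x (fun i => σ (leftPos k i)) (fun i => σ (rightPos k i))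

theorem ins_apply (F G : RawForm E) {n : ℕ} (ι : Fin n → ℤ) (x : ∀ j, E (ι j)) :
    ins 𝕜 E F G n ι x = ∑ k : Fin (n + 1),
      ∑ σ ∈ Finset.univ.filter (fun σ : Equiv.Perm (Fin n) => IsShuffle (k : ℕ) σ),
        insTerm 𝕜 F G ι x k σ := rfl

theorem insTerm_comp_swap (F G : RawForm E) {n : ℕ} (ι : Fin n → ℤ) (x : ∀ j, E (ι j))
    (k : Fin (n + 1)) (σ : Equiv.Perm (Fin n)) {p q : Fin n} (hpq : (p : ℕ) + 1 = q) :
    insTerm 𝕜 F G (fun j => ι (Equiv.swap p q j)) (fun j => x (Equiv.swap p q j)) k σ =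
      (-1 : 𝕜) ^ (ι p * ι q) • insTerm 𝕜 F G ι x k (Equiv.swap p q * σ) := by
  rw [insTerm, koszulSign_comp_swap ι σ hpq, mul_smul]
  rfl

theorem swap_apply_map {α β : Type*} [DecidableEq α] [DecidableEq β] {f : α → β}
    (hf : Function.Injective f) (a b i : α) :
    Equiv.swap (f a) (f b) (f i) = f (Equiv.swap a b i) :=
  (hf.map_swap a b i).symm

theorem insTerm_mul_swap {F G : RawForm E} (hF : IsGradedSym 𝕜 E F) (hG : IsGradedSym 𝕜 E G)
    (hG' : IsHomogeneous 𝕜 G) {n : ℕ} (ι : Fin n → ℤ) (x : ∀ j, E (ι j)) (k : Fin (n + 1))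
    (σ : Equiv.Perm (Fin n)) {a b : Fin n} (hab : (a : ℕ) + 1 = b)
    (hk : (b : ℕ) < k ∨ (k : ℕ) ≤ a) :
    insTerm 𝕜 F G ι x k (σ * Equiv.swap a b) = insTerm 𝕜 F G ι x k σ := by
  rw [insTerm, insTerm, koszulSign_mul_swap ι σ hab]
  simp only [Equiv.Perm.mul_apply]
  rcases hk with hk | hk
  · obtain ⟨a, rfl⟩ := exists_leftPos k (show (a : ℕ) < k by omega)
    obtain ⟨b, rfl⟩ := exists_leftPos k hk
    simp only [swap_apply_map (leftPos_injective k), fun i => Equiv.swap_apply_of_ne_of_ne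
      (leftPos_ne_rightPos k a i).symm (leftPos_ne_rightPos k b i).symm]
    rw [blockTerm_swap_left hF hG' ι x (fun i => σ (leftPos k i)) _ a b hab, smul_smul,
      mul_right_comm, neg_one_zpow_mul_self, one_mul]
  · obtain ⟨a, rfl⟩ := exists_rightPos k hk
    obtain ⟨b, rfl⟩ := exists_rightPos k (show (k : ℕ) ≤ b by omega)
    simp only [swap_apply_map (rightPos_injective k), fun i => Equiv.swap_apply_of_ne_of_ne
      (leftPos_ne_rightPos k i a) (leftPos_ne_rightPos k i b)]
    rw [blockTerm_swap_right hG ι x _ (fun i => σ (rightPos k i)) a b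
        (by simp only [rightPos] at hab; omega), smul_smul,
      mul_right_comm, neg_one_zpow_mul_self, one_mul]

theorem IsShuffle.exists_swap_mul_eq {n k : ℕ} {σ : Equiv.Perm (Fin n)} (hσ : IsShuffle k σ)
    {p q : Fin n} (hpq : (p : ℕ) + 1 = q) (h : ¬IsShuffle k (Equiv.swap p q * σ)) :
    ∃ a b : Fin n, (a : ℕ) + 1 = b ∧ ((b : ℕ) < k ∨ k ≤ (a : ℕ)) ∧
      Equiv.swap p q * σ = σ * Equiv.swap a b := by
  unfold IsShuffle at h
  push Not at h
  obtain ⟨i, j, hij, hk, hle⟩ := h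
  have hlt := hσ i j hij hk
  have hp : σ i = p ∧ σ j = q := by
    by_contra hne
    have := (swap_adjacent_lt_iff hpq hne (i := σ i) (j := σ j) (by
      rintro ⟨h1, h2⟩
      rw [h1, h2, Fin.lt_def] at hlt
      omega)).mpr hlt
    exact absurd this (not_lt.mpr hle)
  refine ⟨i, j, ?_, hk, ?_⟩
  · by_contra hne
    have hij' : (i : ℕ) < j := hij
    let c : Fin n := ⟨i + 1, by omega⟩
    have hic : σ i < σ c := hσ i c (by simp [c, Fin.lt_def]) (by
      rcases hk with hk | hk
      · left; simp only [c]; omega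
      · right; exact hk)
    have hcj : σ c < σ j := hσ c j (by simp only [c, Fin.lt_def]; omega) (by
      rcases hk with hk | hk
      · left; exact hk
      · right; simp only [c]; omega)
    rw [hp.1, Fin.lt_def] at hic
    rw [hp.2, Fin.lt_def] at hcj
    omega
  · rw [Equiv.mul_swap_eq_swap_mul, hp.1, hp.2]

theorem IsGradedSym.ins {F G : RawForm E} (hF : IsGradedSym 𝕜 E F) (hG : IsGradedSym 𝕜 E G)
    (hG' : IsHomogeneous 𝕜 G) : IsGradedSym 𝕜 E (ins 𝕜 E F G) := by
  intro n ι x p q hpq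
  rw [ins_apply, ins_apply, Finset.smul_sum]
  refine Finset.sum_congr rfl fun k _ => ?_
  simp only [insTerm_comp_swap F G ι x k _ hpq]
  rw [← Finset.smul_sum]
  congr 1
  let φ : Equiv.Perm (Fin n) → Equiv.Perm (Fin n) := fun σ =>
    if IsShuffle (k : ℕ) (Equiv.swap p q * σ) then Equiv.swap p q * σ else σ
  have hmem : ∀ σ ∈ Finset.univ.filter (fun σ : Equiv.Perm (Fin n) => IsShuffle (k : ℕ) σ),
      φ σ ∈ Finset.univ.filter (fun σ : Equiv.Perm (Fin n) => IsShuffle (k : ℕ) σ) := by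
    intro σ hσ
    simp only [φ]
    split_ifs with h
    · simpa using h
    · exact hσ
  have hinv : ∀ σ ∈ Finset.univ.filter (fun σ : Equiv.Perm (Fin n) => IsShuffle (k : ℕ) σ),
      φ (φ σ) = σ := by
    intro σ hσ
    rw [Finset.mem_filter] at hσ
    by_cases h : IsShuffle (k : ℕ) (Equiv.swap p q * σ)
    · simp only [φ, if_pos h, Equiv.swap_mul_self_mul, if_pos hσ.2]
    · simp only [φ, if_neg h]
  refine Finset.sum_nbij' φ φ hmem hmem hinv hinv fun σ hσ => ?_
  rw [Finset.mem_filter] at hσ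
  by_cases h : IsShuffle (k : ℕ) (Equiv.swap p q * σ)
  · simp only [φ, if_pos h]
  · simp only [φ, if_neg h]
    obtain ⟨a, b, hab, hk, heq⟩ := hσ.2.exists_swap_mul_eq hpq h
    rw [heq, insTerm_mul_swap hF hG hG' ι x k σ hab hk]

theorem IsHomogeneous.ins {F G : RawForm E} (hF : IsHomogeneous 𝕜 F)
    (hG : IsHomogeneous 𝕜 G) : IsHomogeneous 𝕜 (ins 𝕜 E F G) := by
  intro n ι x j c
  rw [ins_apply, ins_apply, Finset.smul_sum]
  refine Finset.sum_congr rfl fun k _ => ?_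
  rw [Finset.smul_sum]
  refine Finset.sum_congr rfl fun σ _ => ?_
  rw [insTerm, insTerm, smul_comm c]
  congr 1
  have hl : Function.Injective fun i => σ (leftPos k i) := σ.injective.comp (leftPos_injective k)
  have hr : Function.Injective fun i => σ (rightPos k i) :=
    σ.injective.comp (rightPos_injective k)
  obtain ⟨j, rfl⟩ := σ.surjective j
  rw [blockTerm, blockTerm]
  rcases lt_or_ge (j : ℕ) k with h | h
  · obtain ⟨j, rfl⟩ := exists_leftPos k h
    rw [Function.update_comp_eq_of_injective' x hl j,
      hF k (fun i => ι (σ (leftPos k i))) (fun i => x (σ (leftPos k i))) j c, plug_smul hG]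
    congr 2
    funext i
    exact Function.update_of_ne (σ.injective.ne (leftPos_ne_rightPos k j i).symm) _ _
  · obtain ⟨j, rfl⟩ := exists_rightPos k h
    rw [Function.update_comp_eq_of_injective' x hr j,
      plug_update hG c _ (fun i => ι (σ (rightPos k i))) (fun i => x (σ (rightPos k i))) j]
    congr 3
    funext i
    exact Function.update_of_ne (σ.injective.ne (leftPos_ne_rightPos k i j)) _ _

theorem IsOfDeg.ins {F G : RawForm E} {d e : ℤ} (hF : IsOfDeg E d F) (hG : IsOfDeg E e G) :
    IsOfDeg E (d + e) (ins 𝕜 E F G) := by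
  intro n ι x m hm
  rw [ins_apply, DFinsupp.finsetSum_apply]
  refine Finset.sum_eq_zero fun k _ => ?_
  rw [DFinsupp.finsetSum_apply]
  refine Finset.sum_eq_zero fun σ _ => ?_
  rw [insTerm, DirectSum.smul_apply, blockTerm,
    plug_apply_eq_zero hG (fun m => hF _ _ _ m), smul_zero]
  intro h
  apply hm
  rw [h, ← Equiv.sum_comp σ, ← sum_leftPos_add_sum_rightPos k]
  ring

theorem insTerm_eq_zero {F G : RawForm E} {n : ℕ} (ι : Fin n → ℤ) (x : ∀ j, E (ι j))
    {k : Fin (n + 1)} (h : (∀ ι x, F k ι x = 0) ∨ ∀ ι x, G (n - k + 1) ι x = 0)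
    (σ : Equiv.Perm (Fin n)) : insTerm 𝕜 F G ι x k σ = 0 := by
  rw [insTerm, blockTerm]
  rcases h with h | h
  · rw [h, plug_zero, smul_zero]
  · rw [plug, DFinsupp.sum, Finset.sum_eq_zero fun _ _ => h _ _, smul_zero]

theorem ins_eq_zero {F G : RawForm E} {n : ℕ} (ι : Fin n → ℤ) (x : ∀ j, E (ι j))
    (h : ∀ k ≤ n, (∀ ι x, F k ι x = 0) ∨ ∀ ι x, G (n - k + 1) ι x = 0) :
    ins 𝕜 E F G n ι x = 0 := by
  rw [ins_apply]
  exact Finset.sum_eq_zero fun k _ => Finset.sum_eq_zero fun σ _ =>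
    insTerm_eq_zero ι x (h k (Nat.le_of_lt_succ k.isLt)) σ

theorem ins_eq_sum_of_unique {F G : RawForm E} {n : ℕ} (ι : Fin n → ℤ) (x : ∀ j, E (ι j))
    (k₀ : Fin (n + 1))
    (h : ∀ k : Fin (n + 1), k ≠ k₀ → (∀ ι x, F k ι x = 0) ∨ ∀ ι x, G (n - k + 1) ι x = 0) :
    ins 𝕜 E F G n ι x =
      ∑ σ ∈ Finset.univ.filter (fun σ : Equiv.Perm (Fin n) => IsShuffle (k₀ : ℕ) σ),
        insTerm 𝕜 F G ι x k₀ σ := by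
  rw [ins_apply]
  exact Finset.sum_eq_single k₀ (fun k _ hk => Finset.sum_eq_zero fun σ _ =>
    insTerm_eq_zero ι x (h k hk) σ) (fun hk => absurd (Finset.mem_univ _) hk)

theorem ins_add_right (F G H : RawForm E) :
    ins 𝕜 E F (G + H) = ins 𝕜 E F G + ins 𝕜 E F H := by
  funext n ι x
  simp only [Pi.add_apply, ins_apply, insTerm, blockTerm, plug_add_form, smul_add,
    Finset.sum_add_distrib]

theorem ins_add_left (F F' : RawForm E) {G : RawForm E} (hG : IsAdditiveFirst G) :
    ins 𝕜 E (F + F') G = ins 𝕜 E F G + ins 𝕜 E F' G := by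
  funext n ι x
  simp only [Pi.add_apply, ins_apply, insTerm, blockTerm, plug_add hG, smul_add,
    Finset.sum_add_distrib]

theorem ins_add_left_of_disjoint {F F' : RawForm E} (G : RawForm E)
    (h : ∀ k, (∀ ι x, F k ι x = 0) ∨ ∀ ι x, F' k ι x = 0) :
    ins 𝕜 E (F + F') G = ins 𝕜 E F G + ins 𝕜 E F' G := by
  funext n ι x
  simp only [Pi.add_apply, ins_apply, insTerm, blockTerm]
  simp only [← Finset.sum_add_distrib, ← smul_add]
  refine Finset.sum_congr rfl fun k _ => Finset.sum_congr rfl fun σ _ => ?_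
  rcases h k with h | h
  · simp only [h, zero_add, plug_zero]
  · simp only [h, add_zero, plug_zero]

theorem rnb_zero_left (e : ℤ) (F G : RawForm E) :
    rnb 𝕜 E 0 e F G = ins 𝕜 E F G - ins 𝕜 E G F := by
  funext n ι x
  simp [rnb]

theorem rnb_add_left_of_disjoint (e : ℤ) {F F' : RawForm E} (G : RawForm E)
    (h : ∀ k, (∀ ι x, F k ι x = 0) ∨ ∀ ι x, F' k ι x = 0) :
    rnb 𝕜 E 0 e (F + F') G = rnb 𝕜 E 0 e F G + rnb 𝕜 E 0 e F' G := by
  rw [rnb_zero_left, rnb_zero_left, rnb_zero_left, ins_add_left_of_disjoint G h, ins_add_right]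
  abel

theorem rnb_add_left (e : ℤ) (F F' : RawForm E) {G : RawForm E} (hG : IsAdditiveFirst G) :
    rnb 𝕜 E 0 e (F + F') G = rnb 𝕜 E 0 e F G + rnb 𝕜 E 0 e F' G := by
  rw [rnb_zero_left, rnb_zero_left, rnb_zero_left, ins_add_left F F' hG, ins_add_right]
  abel

theorem rnb_add_right (e : ℤ) {F : RawForm E} (hF : IsAdditiveFirst F) (G H : RawForm E) :
    rnb 𝕜 E 0 e F (G + H) = rnb 𝕜 E 0 e F G + rnb 𝕜 E 0 e F H := by
  rw [rnb_zero_left, rnb_zero_left, rnb_zero_left, ins_add_left G H hF, ins_add_right]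
  abel

variable (𝕜) in
/-- Graded symmetric homogeneous maps of degree `d`. -/
structure IsForm (d : ℤ) (F : RawForm E) : Prop where
  homogeneous : IsHomogeneous 𝕜 F
  gradedSym : IsGradedSym 𝕜 E F
  ofDeg : IsOfDeg E d F

theorem IsSVF.isForm {d : ℤ} {F : RawForm E} (hF : IsSVF 𝕜 E d F) : IsForm 𝕜 d F :=
  ⟨hF.1.isHomogeneous, hF.2.1, hF.2.2⟩

theorem IsForm.add {d : ℤ} {F G : RawForm E} (hF : IsForm 𝕜 d F) (hG : IsForm 𝕜 d G) :
    IsForm 𝕜 d (F + G) where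
  homogeneous n ι x j c := by
    simp only [Pi.add_apply, hF.homogeneous n ι x j c, hG.homogeneous n ι x j c, smul_add]
  gradedSym n ι x p q hpq := by
    simp only [Pi.add_apply, hF.gradedSym n ι x p q hpq, hG.gradedSym n ι x p q hpq, smul_add]
  ofDeg n ι x m hm := by
    simp only [Pi.add_apply, DirectSum.add_apply, hF.ofDeg n ι x m hm, hG.ofDeg n ι x m hm,
      add_zero]

theorem IsForm.sub {d : ℤ} {F G : RawForm E} (hF : IsForm 𝕜 d F) (hG : IsForm 𝕜 d G) :
    IsForm 𝕜 d (F - G) where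
  homogeneous n ι x j c := by
    simp only [Pi.sub_apply, hF.homogeneous n ι x j c, hG.homogeneous n ι x j c, smul_sub]
  gradedSym n ι x p q hpq := by
    simp only [Pi.sub_apply, hF.gradedSym n ι x p q hpq, hG.gradedSym n ι x p q hpq, smul_sub]
  ofDeg n ι x m hm := by
    simp only [Pi.sub_apply, DirectSum.sub_apply, hF.ofDeg n ι x m hm, hG.ofDeg n ι x m hm,
      sub_zero]

theorem IsForm.ins {d e : ℤ} {F G : RawForm E} (hF : IsForm 𝕜 d F) (hG : IsForm 𝕜 e G) :
    IsForm 𝕜 (d + e) (ins 𝕜 E F G) :=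
  ⟨hF.homogeneous.ins hG.homogeneous, hF.gradedSym.ins hG.gradedSym hG.homogeneous,
    hF.ofDeg.ins hG.ofDeg⟩

theorem IsForm.rnb_zero_left {e : ℤ} {F G : RawForm E} (hF : IsForm 𝕜 0 F)
    (hG : IsForm 𝕜 e G) : IsForm 𝕜 e (rnb 𝕜 E 0 e F G) := by
  rw [RN.rnb_zero_left]
  have h1 := hF.ins hG
  have h2 := hG.ins hF
  rw [zero_add] at h1
  rw [add_zero] at h2
  exact h1.sub h2

theorem euler_one (ι : Fin 1 → ℤ) (x : ∀ j, E (ι j)) :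
    euler E 1 ι x = (-ι 0) • DirectSum.of E (ι 0) (x 0) := rfl

theorem isArity_euler : IsArity E 1 (euler E) := fun _ hn _ _ => dif_neg hn

variable (𝕜 E) in
theorem isForm_euler : IsForm 𝕜 0 (euler E) where
  homogeneous n ι x j c := by
    by_cases hn : n = 1
    · subst hn
      obtain rfl := Subsingleton.elim j 0
      rw [euler_one, euler_one, Function.update_self, smul_comm c]
      congr 1
      exact DirectSum.of_smul 𝕜 _ c (x 0)
    · rw [isArity_euler n hn, isArity_euler n hn, smul_zero]
  gradedSym n ι x p q hpq := by
    have hn : n ≠ 1 := by have := q.isLt; have := p.isLt; omega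
    rw [isArity_euler n hn, isArity_euler n hn, smul_zero]
  ofDeg n ι x m hm := by
    by_cases hn : n = 1
    · subst hn
      have h : m ≠ ι 0 := by simpa using hm
      rw [euler_one, DFinsupp.smul_apply, DirectSum.of_eq_of_ne _ _ _ h, smul_zero]
    · rw [isArity_euler n hn]; rfl

theorem apply_dcons_comp (G : RawForm E) {n l : ℕ} (ι : Fin n → ℤ) (x : ∀ j, E (ι j))
    (f : Fin (l + 1) → Fin n) :
    G (l + 1) (dcons (ι (f 0)) fun i => ι (f i.succ))
      (dconsV E (x (f 0)) fun i => x (f i.succ)) =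
    G (l + 1) (fun i => ι (f i)) fun i => x (f i) := by
  have hι : dcons (ι (f 0)) (fun i => ι (f i.succ)) = fun i => ι (f i) := by
    funext j
    exact Fin.cases rfl (fun i => rfl) j
  have hx : HEq (dconsV E (x (f 0)) fun i => x (f i.succ)) (fun i => x (f i)) := by
    refine Function.hfunext rfl fun j j' hj => ?_
    obtain rfl := eq_of_heq hj
    exact Fin.cases HEq.rfl (fun i => HEq.rfl) j
  congr 1

theorem insTerm_euler {G : RawForm E} (hG : IsHomogeneous 𝕜 G) (hG' : IsGradedSym 𝕜 E G)
    {n : ℕ} (ι : Fin (n + 1) → ℤ) (x : ∀ j, E (ι j)) (σ : Equiv.Perm (Fin (n + 1))) :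
    insTerm 𝕜 (euler E) G ι x ⟨1, by omega⟩ σ = (-ι (σ 0)) • G (n + 1) ι x := by
  have hr : (fun i => σ (rightPos (⟨1, by omega⟩ : Fin (n + 2)) i)) =
      fun i : Fin n => σ i.succ := by
    funext i
    exact congrArg σ (Fin.ext (Nat.add_comm _ _))
  rw [insTerm]
  have h : blockTerm (euler E) G ι x
      (fun i => σ (leftPos (⟨1, by omega⟩ : Fin (n + 2)) i)) (fun i : Fin n => σ i.succ) =
      (-ι (σ 0)) • koszulSign 𝕜 ι σ • G (n + 1) ι x := by
    rw [← hG'.apply_perm σ, ← apply_dcons_comp G ι x σ, ← plug_of hG,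
      ← Int.cast_smul_eq_zsmul 𝕜, ← plug_smul hG, Int.cast_smul_eq_zsmul]
    rfl
  refine (congrArg (koszulSign 𝕜 ι σ • ·) ((congrArg (blockTerm (euler E) G ι x _) hr).trans
    h)).trans ?_
  rw [smul_comm (koszulSign 𝕜 ι σ) (-ι (σ 0)), smul_smul, koszulSign_mul_self, one_smul]

theorem IsShuffle.eq_cycleRange_symm {n : ℕ} {σ : Equiv.Perm (Fin (n + 1))}
    (hσ : IsShuffle 1 σ) : (σ 0).cycleRange.symm = σ := by
  have h1 : StrictMono fun i : Fin n => σ i.succ := fun i j hij =>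
    hσ _ _ (Fin.succ_lt_succ_iff.mpr hij) (Or.inr (by simp))
  have hrange : Set.range (σ 0).succAbove = Set.range fun i : Fin n => σ i.succ := by
    rw [Fin.range_succAbove]
    ext j
    simp only [Set.mem_compl_iff, Set.mem_singleton_iff, Set.mem_range]
    constructor
    · intro h
      obtain ⟨i, rfl⟩ := σ.surjective j
      obtain ⟨i, rfl⟩ := Fin.exists_succ_eq.mpr (fun hi : i = 0 => h (by rw [hi]))
      exact ⟨i, rfl⟩
    · rintro ⟨i, rfl⟩
      exact σ.injective.ne (Fin.succ_ne_zero i)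
  have h := (StrictMono.range_inj (Fin.strictMono_succAbove (σ 0)) h1).mp hrange
  ext j : 1
  refine Fin.cases ?_ (fun i => ?_) j
  · rw [Fin.cycleRange_symm_zero]
  · rw [Fin.cycleRange_symm_succ, h]

theorem isShuffle_cycleRange_symm {n : ℕ} (i : Fin (n + 1)) :
    IsShuffle 1 i.cycleRange.symm := by
  intro a b hab h
  obtain ⟨b, rfl⟩ := Fin.exists_succ_eq.mpr (Fin.ne_zero_of_lt hab)
  obtain ⟨a, rfl⟩ := Fin.exists_succ_eq.mpr (show a ≠ 0 by
    rintro rfl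
    simp at h)
  rw [Fin.cycleRange_symm_succ, Fin.cycleRange_symm_succ]
  exact Fin.strictMono_succAbove i (Fin.succ_lt_succ_iff.mp hab)

theorem sum_shuffle_one {n : ℕ} (g : Fin (n + 1) → ℤ) :
    ∑ σ ∈ Finset.univ.filter (fun σ : Equiv.Perm (Fin (n + 1)) => IsShuffle 1 σ), g (σ 0) =
      ∑ i, g i :=
  Finset.sum_nbij' (fun σ => σ 0) (fun i => i.cycleRange.symm) (fun _ _ => Finset.mem_univ _)
    (fun i _ => Finset.mem_filter.mpr ⟨Finset.mem_univ _, isShuffle_cycleRange_symm i⟩)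
    (fun _ hσ => (Finset.mem_filter.mp hσ).2.eq_cycleRange_symm)
    (fun i _ => Fin.cycleRange_symm_zero i) (fun _ _ => rfl)

theorem ins_euler_left {G : RawForm E} (hG : IsHomogeneous 𝕜 G) (hG' : IsGradedSym 𝕜 E G)
    {n : ℕ} (ι : Fin n → ℤ) (x : ∀ j, E (ι j)) :
    ins 𝕜 E (euler E) G n ι x = (-∑ j, ι j) • G n ι x := by
  cases n with
  | zero =>
    rw [ins_eq_zero ι x fun k hk => Or.inl (isArity_euler k (by omega))]
    simp
  | succ n =>
    rw [ins_eq_sum_of_unique ι x ⟨1, by omega⟩ fun k hk =>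
      Or.inl (isArity_euler k fun h => hk (Fin.ext h))]
    simp only [insTerm_euler hG hG']
    rw [← Finset.sum_smul, sum_shuffle_one (fun i => -ι i), Finset.sum_neg_distrib]

theorem plug_euler {f : ⨁ i, E i} {m₀ : ℤ} (hf : ∀ m, m ≠ m₀ → f m = 0) {l : ℕ} (hl : l = 0)
    (rest : Fin l → ℤ) (xs : ∀ j, E (rest j)) :
    plug (euler E) f rest xs = (-m₀) • f := by
  subst hl
  have h : f = DirectSum.of E m₀ (f m₀) := by
    ext m : 1
    by_cases hm : m = m₀
    · subst hm; rw [DirectSum.of_eq_same]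
    · rw [hf m hm, DirectSum.of_eq_of_ne _ _ _ hm]
  rw [h]
  refine (DFinsupp.sum_single_index
    (h := fun m v => euler E 1 (dcons m rest) (dconsV E v xs)) ?_).trans rfl
  rw [euler_one]
  exact (congrArg _ (map_zero _)).trans (smul_zero _)

theorem IsShuffle.eq_one {n : ℕ} {σ : Equiv.Perm (Fin n)} (hσ : IsShuffle n σ) : σ = 1 := by
  have h : StrictMono σ := fun i j hij => hσ i j hij (Or.inl j.isLt)
  have h' := (StrictMono.range_inj h strictMono_id).mp (by
    rw [σ.surjective.range_eq, Set.range_id])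
  ext j : 1
  exact congrFun h' j

theorem ins_euler_right {d : ℤ} {F : RawForm E} (hF : IsOfDeg E d F) {n : ℕ}
    (ι : Fin n → ℤ) (x : ∀ j, E (ι j)) :
    ins 𝕜 E F (euler E) n ι x = (-(∑ j, ι j + d)) • F n ι x := by
  rw [ins_eq_sum_of_unique ι x (Fin.last n) fun k hk => Or.inr (isArity_euler _ fun h => hk
    (Fin.ext (by have := k.isLt; simp only [Fin.val_last]; omega))),
    Finset.sum_eq_single 1]
  · rw [insTerm, koszulSign_one, one_smul, blockTerm]
    exact plug_euler (fun m hm => hF n ι x m hm) (by simp) _ _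
  · intro σ hσ h
    exact absurd (Finset.mem_filter.mp hσ).2.eq_one h
  · intro h
    exact absurd (Finset.mem_filter.mpr ⟨Finset.mem_univ _, fun i j hij _ => hij⟩) h

theorem IsForm.rnb_euler {d : ℤ} {F : RawForm E} (hF : IsForm 𝕜 d F) :
    rnb 𝕜 E 0 d (euler E) F = d • F := by
  funext n ι x
  rw [RN.rnb_zero_left]
  simp only [Pi.sub_apply, Pi.smul_apply]
  rw [ins_euler_left hF.homogeneous hF.gradedSym, ins_euler_right hF.ofDeg, ← sub_smul]
  congr 1
  ring

theorem apply_eq_zero_of_arity_ge {n : ℕ}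
    (hconc : ∀ i : ℤ, (i < -(n : ℤ) ∨ (-1 : ℤ) < i) → ∀ v : E i, v = 0) {F : RawForm E}
    (hF : IsHomogeneous 𝕜 F) (hF' : IsOfDeg E 1 F) {a : ℕ} (ha : n + 2 ≤ a)
    (ι : Fin a → ℤ) (x : ∀ j, E (ι j)) : F a ι x = 0 := by
  by_cases h : ∃ j, -1 < ι j
  · obtain ⟨j, hj⟩ := h
    exact hF.apply_eq_zero (hconc _ (Or.inr hj) (x j))
  · push Not at h
    ext m : 1
    by_cases hm : m = ∑ j, ι j + 1
    · refine hconc m (Or.inl ?_) _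
      have : ∑ j, ι j ≤ -(a : ℤ) := by
        simpa using Finset.sum_le_card_nsmul Finset.univ ι (-1) fun j _ => h j
      omega
    · exact hF' _ _ _ _ hm

theorem rnb_eq_zero_of_low {n k : ℕ} (hk2 : k ≤ n + 1)
    (hconc : ∀ i : ℤ, (i < -(n : ℤ) ∨ (-1 : ℤ) < i) → ∀ v : E i, v = 0)
    {N G : RawForm E} (hN : IsHomogeneous 𝕜 N) (hN' : IsOfDeg E 0 N) (hNa : IsArity E k N)
    (hG : IsHomogeneous 𝕜 G) (hG' : IsOfDeg E 1 G)
    (hlow : ∀ a ≤ n + 2 - k, ∀ ι x, G a ι x = 0) : rnb 𝕜 E 0 1 N G = 0 := by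
  funext a ι x
  rw [rnb_zero_left, Pi.sub_apply, Pi.sub_apply, Pi.sub_apply]
  rcases le_or_gt (n + 2) a with ha | ha
  · rw [apply_eq_zero_of_arity_ge hconc (hN.ins hG) (hN'.ins hG') ha,
      apply_eq_zero_of_arity_ge hconc (hG.ins hN) (hG'.ins hN') ha, sub_zero]
    rfl
  · rw [ins_eq_zero, ins_eq_zero, sub_zero]
    · rfl
    · intro k' hk'
      by_cases h : a - k' + 1 = k
      · exact Or.inl (hlow k' (by omega))
      · exact Or.inr (hNa _ h)
    · intro k' hk'
      by_cases h : k' = k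
      · exact Or.inr (hlow _ (by omega))
      · exact Or.inl (hNa _ h)

theorem rnb_apply_eq_zero_of_arity_lt {k : ℕ} {N G : RawForm E} (hNa : IsArity E k N)
    (hG : NoCurv E G) (e : ℤ) {a : ℕ} (ha : a < k) (ι : Fin a → ℤ) (x : ∀ j, E (ι j)) :
    rnb 𝕜 E 0 e N G a ι x = 0 := by
  rw [rnb_zero_left, Pi.sub_apply, Pi.sub_apply, Pi.sub_apply, ins_eq_zero, ins_eq_zero,
    sub_zero]
  · intro k' hk'
    rcases Nat.eq_zero_or_pos k' with rfl | h
    · exact Or.inl hG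
    · exact Or.inr (hNa _ (by omega))
  · intro k' hk'
    exact Or.inl (hNa _ (by omega))

theorem sum_comp_apply (μ : RawForm E) (s : Finset ℕ) (a : ℕ) (ι : Fin a → ℤ)
    (x : ∀ j, E (ι j)) :
    (∑ m ∈ s, comp E μ m) a ι x = if a ∈ s then μ a ι x else 0 := by
  simp only [Finset.sum_apply, comp, Finset.sum_ite_eq]

theorem rnb_eq_sum_comp {n k : ℕ} (hk2 : k ≤ n + 1)
    (hconc : ∀ i : ℤ, (i < -(n : ℤ) ∨ (-1 : ℤ) < i) → ∀ v : E i, v = 0)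
    {N μ : RawForm E} (hN : IsSVF 𝕜 E 0 N) (hNa : IsArity E k N) (hμ : IsSVF 𝕜 E 1 μ)
    (hμc : NoCurv E μ) :
    rnb 𝕜 E 0 1 N μ = ∑ m ∈ Finset.Icc 1 (n - k + 2), rnb 𝕜 E 0 1 N (comp E μ m) := by
  have hadd := rnb_add_right (𝕜 := 𝕜) 1 hN.1.isAdditiveFirst
  let R : RawForm E := fun a ι x => if a ∈ Finset.Icc 1 (n - k + 2) then 0 else μ a ι x
  have hR : rnb 𝕜 E 0 1 N R = 0 := by
    refine rnb_eq_zero_of_low hk2 hconc hN.1.isHomogeneous hN.2.2 hNa ?_ ?_ ?_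
    · intro a ι x j c
      simp only [R]
      split_ifs
      · rw [smul_zero]
      · exact hμ.1.isHomogeneous a ι x j c
    · intro a ι x m hm
      simp only [R]
      split_ifs
      · rfl
      · exact hμ.2.2 a ι x m hm
    · intro a ha ι x
      simp only [R]
      split_ifs with h
      · rfl
      · have : a = 0 := by
          rw [Finset.mem_Icc] at h
          omega
        subst this
        exact hμc ι x
  have hsplit : μ = ∑ m ∈ Finset.Icc 1 (n - k + 2), comp E μ m + R := by
    funext a ι x
    rw [Pi.add_apply, Pi.add_apply, Pi.add_apply, sum_comp_apply]
    simp only [R]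
    split_ifs
    · rw [add_zero]
    · rw [zero_add]
  have hsum := map_sum (AddMonoidHom.mk' (rnb 𝕜 E 0 1 N) hadd) (comp E μ)
    (Finset.Icc 1 (n - k + 2))
  conv_lhs => rw [hsplit]
  rw [hadd, hR, add_zero]
  exact hsum

end Forms

/-- Let `(E = E_{-n} ⊕ ⋯ ⊕ E_{-1}, μ = l₁ + ⋯ + l_{n+1})` be a symmetric
Lie `n`-algebra, let `(n+3)/2 ≤ k ≤ n+1` and let `N` be any symmetric vector valued `k`-form
of degree 0 on `E`.  Then `S + N` is Nijenhuis with respect to `μ` with square `S + 2N`, and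
the deformed `L∞`-structure is
`[S+N,μ]_RN = l₁ + ⋯ + l_{k-1} + (l_k + [N,l₁]_RN) + ⋯ + (l_{n+1} + [N,l_{n-k+2}]_RN)
 = μ + ∑_{m=1}^{n-k+2} [N,l_m]_RN`. -/
theorem statement16 (𝕜 : Type) [Field 𝕜] [CharZero 𝕜]
    (E : ℤ → Type) [∀ i, AddCommGroup (E i)] [∀ i, Module 𝕜 (E i)]
    (n : ℕ) (hn : 1 ≤ n)
    (hconc : ∀ i : ℤ, (i < -(n : ℤ) ∨ (-1 : ℤ) < i) → ∀ v : E i, v = 0)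
    (μ : RawForm E) (hμ : IsSVF 𝕜 E 1 μ) (hμc : NoCurv E μ)
    (hμμ : rnb 𝕜 E 1 1 μ μ = 0)
    (k : ℕ) (hk1 : n + 3 ≤ 2 * k) (hk2 : k ≤ n + 1)
    (N : RawForm E) (hN : IsSVF 𝕜 E 0 N) (hNa : IsArity E k N) :
    rnb 𝕜 E 0 1 (euler E + N) (rnb 𝕜 E 0 1 (euler E + N) μ) =
        rnb 𝕜 E 0 1 (euler E + (2 : ℤ) • N) μ ∧
      rnb 𝕜 E 0 0 (euler E + N) (euler E + (2 : ℤ) • N) = 0 ∧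
      rnb 𝕜 E 0 1 (euler E + N) μ =
        μ + ∑ m ∈ Finset.Icc 1 (n - k + 2), rnb 𝕜 E 0 1 N (comp E μ m) := by
  have hdisj : ∀ a, (∀ ι x, euler E a ι x = 0) ∨ ∀ ι x, N a ι x = 0 := fun a => by
    by_cases ha : a = 1
    · exact Or.inr (hNa a (by omega))
    · exact Or.inl (isArity_euler a ha)
  have hdisj' : ∀ a, (∀ ι x, euler E a ι x = 0) ∨ ∀ ι x, (N + N) a ι x = 0 := fun a =>
    (hdisj a).imp_right fun h ι x => by
      rw [Pi.add_apply, Pi.add_apply, Pi.add_apply, h, add_zero]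
  have hNf := hN.isForm
  have hμf := hμ.isForm
  have hQf := hNf.rnb_zero_left hμf
  have hdeform : rnb 𝕜 E 0 1 (euler E + N) μ = μ + rnb 𝕜 E 0 1 N μ := by
    rw [rnb_add_left_of_disjoint 1 μ hdisj, hμf.rnb_euler, one_smul]
  have hNQ : rnb 𝕜 E 0 1 N (rnb 𝕜 E 0 1 N μ) = 0 :=
    rnb_eq_zero_of_low hk2 hconc hNf.homogeneous hNf.ofDeg hNa hQf.homogeneous hQf.ofDeg
      fun a ha => rnb_apply_eq_zero_of_arity_lt hNa hμc 1 (by omega)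
  rw [two_zsmul]
  refine ⟨?_, ?_, ?_⟩
  · rw [hdeform, rnb_add_left_of_disjoint 1 _ hdisj, rnb_add_left_of_disjoint 1 _ hdisj',
      (hμf.add hQf).rnb_euler, hμf.rnb_euler, rnb_add_right 1 hN.1.isAdditiveFirst, hNQ,
      rnb_add_left 1 N N hμ.1.isAdditiveFirst, one_smul, one_smul]
    abel
  · have hSN : rnb 𝕜 E 0 0 (euler E) N = 0 := by rw [hNf.rnb_euler, zero_smul]
    rw [rnb_zero_left, sub_eq_zero] at hSN
    rw [rnb_add_left_of_disjoint 0 _ hdisj,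
      ((isForm_euler 𝕜 E).add (hNf.add hNf)).rnb_euler, zero_smul, zero_add, rnb_zero_left,
      ins_add_right, ins_add_right, ins_add_left_of_disjoint _ hdisj',
      ins_add_left N N hN.1.isAdditiveFirst, hSN, sub_self]
  · rw [hdeform, rnb_eq_sum_comp hk2 hconc hN hNa hμ hμc]

end RN
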